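/- Let N = E₁₂ + E₂₃ ∈ M₄(ℂ) (a nilpotent matrix of Jordan type (3,1)). Then N cannot be conjugated into gsp₄(ℂ): there is no invertible matrix A ∈ GL₄(ℂ) such that A N A⁻¹ ∈ gsp₄(ℂ), i.e., such that (A N A⁻¹)ᵀ J + J (A N A⁻¹) = μJ for some μ ∈ ℂ. -/

import Mathlib

open Matrix
open scoped Matrix

noncomputable section

/-- The antidiagonal symplectic form on `ℂ⁴`. -/
def J4 : Matrix (Fin 4) (Fin 4) ℂ :=
  !![0, 0, 0, 1; 0, 0, 1, 0; 0, -1, 0, 0; -1, 0, 0, 0]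

/-- The nilpotent matrix `N = E₁₂ + E₂₃` of Jordan type `(3,1)`. -/
def N : Matrix (Fin 4) (Fin 4) ℂ :=
  !![0, 1, 0, 0; 0, 0, 1, 0; 0, 0, 0, 0; 0, 0, 0, 0]

/-- A skew-symmetric form for which `N` is an infinitesimal similitude is degenerate: its first
row vanishes. -/
lemma first_row_eq_zero_of_similitude {K : Matrix (Fin 4) (Fin 4) ℂ} {μ : ℂ} (hK : Kᵀ = -K)
    (h : Nᵀ * K + K * N = μ • K) (j : Fin 4) : K 0 j = 0 := by
  have diag (i : Fin 4) : K i i = 0 := self_eq_neg.mp (congrFun₂ hK i i)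
  have entry (i j : Fin 4) := congrFun₂ h i j
  have h01 := entry 0 1
  have h02 := entry 0 2
  have h03 := entry 0 3
  have h12 := entry 1 2
  have h13 := entry 1 3
  simp [N, Matrix.mul_apply, Fin.sum_univ_four, diag] at h01 h02 h03 h12 h13
  rcases eq_or_ne μ 0 with rfl | hμ <;> fin_cases j <;> simp_all

/-- The nilpotent matrix `E₁₂ + E₂₃` of Jordan type `(3,1)` cannot be conjugated into
`gsp₄(ℂ)`: there is no `A ∈ GL₄(ℂ)` with `(A N A⁻¹)ᵀ J4 + J4 (A N A⁻¹) = μ J4` for some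
`μ ∈ ℂ`. -/
theorem jordan_three_one_not_conjugate_into_gsp4 :
    ¬ ∃ (A : GL (Fin 4) ℂ) (μ : ℂ),
      ((A : Matrix (Fin 4) (Fin 4) ℂ) * N * (↑A⁻¹ : Matrix (Fin 4) (Fin 4) ℂ))ᵀ * J4 +
        J4 * ((A : Matrix (Fin 4) (Fin 4) ℂ) * N * (↑A⁻¹ : Matrix (Fin 4) (Fin 4) ℂ)) =
        μ • J4 := by
  rintro ⟨A, μ, h⟩
  set B : Matrix (Fin 4) (Fin 4) ℂ := A.val
  have hinv : (↑A⁻¹ : Matrix (Fin 4) (Fin 4) ℂ) * B = 1 := A.inv_mul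
  have hJ : J4ᵀ = -J4 := by
    ext i j
    fin_cases i <;> fin_cases j <;> simp [J4]
  have hJdet : J4.det ≠ 0 := by
    simp [J4, Matrix.det_succ_row_zero, Fin.sum_univ_succ, Fin.succAbove]
  have hskew : (Bᵀ * J4 * B)ᵀ = -(Bᵀ * J4 * B) := by
    simp [Matrix.transpose_mul, hJ, Matrix.mul_assoc]
  have hcancel : B * N * (↑A⁻¹ : Matrix (Fin 4) (Fin 4) ℂ) * B = B * N := by
    rw [Matrix.mul_assoc, hinv, Matrix.mul_one]
  have hsim : Nᵀ * (Bᵀ * J4 * B) + Bᵀ * J4 * B * N = μ • (Bᵀ * J4 * B) := by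
    calc Nᵀ * (Bᵀ * J4 * B) + Bᵀ * J4 * B * N
        = (B * N)ᵀ * J4 * B + Bᵀ * J4 * (B * N) := by
          simp only [Matrix.transpose_mul, Matrix.mul_assoc]
      _ = Bᵀ * ((B * N * (↑A⁻¹ : Matrix (Fin 4) (Fin 4) ℂ))ᵀ * J4 +
            J4 * (B * N * (↑A⁻¹ : Matrix (Fin 4) (Fin 4) ℂ))) * B := by
          conv_lhs => rw [← hcancel]
          rw [Matrix.transpose_mul _ B]
          simp only [Matrix.mul_add, Matrix.add_mul, Matrix.mul_assoc]
      _ = μ • (Bᵀ * J4 * B) := by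
          rw [h, Matrix.mul_smul, Matrix.smul_mul]
  have hBdet : B.det ≠ 0 := (B.isUnit_iff_isUnit_det.mp A.isUnit).ne_zero
  have hdet : (Bᵀ * J4 * B).det ≠ 0 := by
    simp [Matrix.det_mul, hJdet, hBdet]
  exact hdet (Matrix.det_eq_zero_of_row_eq_zero 0 (first_row_eq_zero_of_similitude hskew hsim))

end
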